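/- There exist a constant C > 0 and N₀ ∈ ℕ such that for every integer N ≥ N₀, the high-pass filter of Riemann's non-differentiable function satisfies ‖R_{≥N}‖_{L⁴(𝕋)} ≤ C · N^{-3/4} · (log N)^{1/4}. -/

import Mathlib

open Real MeasureTheory

/-- `σ k = 1` if `k` is a perfect square, `0` otherwise. -/
noncomputable def sqIndicator (k : ℕ) : ℝ := if IsSquare k then 1 else 0

/-- The character `e_k(x) = e^{2πikx}`. -/
noncomputable def eChar (k : ℕ) (x : ℝ) : ℂ :=
  Complex.exp (2 * Real.pi * Complex.I * (k : ℂ) * (x : ℂ))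

/-- Riemann's non-differentiable function `R(x) = ∑_{k≥1} (σ_k/k) e^{2πikx}
    = ∑_{n≥1} e^{2πin²x}/n²`. -/
noncomputable def RiemannF (x : ℝ) : ℂ :=
  ∑' k : ℕ, ((sqIndicator k / k : ℝ) : ℂ) * eChar k x

/-- High-pass filter `R_{≥N}(x) = ∑_{k ≥ N} (σ_k/k) e^{2πikx}`. -/
noncomputable def RiemannHigh (N : ℕ) (x : ℝ) : ℂ :=
  ∑' k : ℕ, if N ≤ k then ((sqIndicator k / k : ℝ) : ℂ) * eChar k x else 0

/-- Orthogonality of the characters `eChar` on `[0, 1]`. -/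
lemma integral_eChar_mul_conj (m n : ℕ) :
    ∫ x in (0:ℝ)..1, eChar m x * (starRingEnd ℂ) (eChar n x) = if m = n then 1 else 0 := by
  have hform : ∀ x : ℝ, eChar m x * (starRingEnd ℂ) (eChar n x) =
      Complex.exp ((2 * Real.pi * Complex.I * ((m : ℂ) - n)) * (x : ℂ)) := by
    intro x
    simp only [eChar, ← Complex.exp_conj, ← Complex.exp_add]
    congr 1
    simp [map_ofNat (starRingEnd ℂ) 2]
    ring
  simp_rw [hform]
  split_ifs with h
  · simp [h]
  · have hmn : (m : ℂ) - n ≠ 0 := sub_ne_zero.mpr (by exact_mod_cast h)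
    have hc : 2 * (Real.pi : ℂ) * Complex.I * ((m : ℂ) - n) ≠ 0 :=
      mul_ne_zero Complex.two_pi_I_ne_zero hmn
    rw [integral_exp_mul_complex hc]
    have hexp := Complex.exp_int_mul_two_pi_mul_I ((m : ℤ) - n)
    push_cast at hexp
    have : Complex.exp (2 * Real.pi * Complex.I * ((m : ℂ) - n) * ((1 : ℝ) : ℂ)) = 1 := by
      rw [← hexp]
      congr 1
      push_cast
      ring
    rw [this]
    simp

lemma continuous_eChar (k : ℕ) : Continuous (eChar k) := by
  unfold eChar
  fun_prop

lemma norm_eChar (k : ℕ) (x : ℝ) : ‖eChar k x‖ = 1 := by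
  rw [eChar, show 2 * (Real.pi : ℂ) * Complex.I * k * x = ((2 * Real.pi * k * x : ℝ) : ℂ) *
    Complex.I by push_cast; ring, Complex.norm_exp_ofReal_mul_I]

lemma eChar_add (k l : ℕ) (x : ℝ) : eChar (k + l) x = eChar k x * eChar l x := by
  simp only [eChar, ← Complex.exp_add]
  congr 1
  push_cast
  ring

/-- Parseval's identity for a finite sum of characters with possibly repeated frequencies. -/
lemma integral_norm_sq_sum_eChar {ι : Type*} (s : Finset ι) (c : ι → ℝ) (φ : ι → ℕ) :
    ∫ x in (0:ℝ)..1, ‖∑ i ∈ s, (c i : ℂ) * eChar (φ i) x‖ ^ 2 =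
      ∑ i ∈ s, ∑ j ∈ s, if φ i = φ j then c i * c j else 0 := by
  have hpt : ∀ x : ℝ, ((‖∑ i ∈ s, (c i : ℂ) * eChar (φ i) x‖ ^ 2 : ℝ) : ℂ) =
      ∑ i ∈ s, ∑ j ∈ s, ((c i * c j : ℝ) : ℂ) *
        (eChar (φ i) x * (starRingEnd ℂ) (eChar (φ j) x)) := by
    intro x
    rw [Complex.ofReal_pow, ← Complex.mul_conj', map_sum, Finset.sum_mul_sum]
    refine Finset.sum_congr rfl fun i _ => Finset.sum_congr rfl fun j _ => ?_
    simp
    ring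
  have hcont : ∀ i j : ι, Continuous fun x : ℝ => ((c i * c j : ℝ) : ℂ) *
      (eChar (φ i) x * (starRingEnd ℂ) (eChar (φ j) x)) := fun i j =>
    continuous_const.mul ((continuous_eChar _).mul
      (Complex.continuous_conj.comp (continuous_eChar _)))
  apply Complex.ofReal_injective
  rw [← intervalIntegral.integral_ofReal]
  simp_rw [hpt]
  rw [intervalIntegral.integral_finsetSum fun i _ =>
    (continuous_finsetSum _ fun j _ => hcont i j).intervalIntegrable _ _]
  rw [Complex.ofReal_sum]
  refine Finset.sum_congr rfl fun i _ => ?_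
  rw [Complex.ofReal_sum, intervalIntegral.integral_finsetSum fun j _ => (hcont i j).intervalIntegrable _ _]
  refine Finset.sum_congr rfl fun j _ => ?_
  rw [intervalIntegral.integral_const_mul, integral_eChar_mul_conj]
  split_ifs <;> simp

/-- The solutions of `a² + b² = c² + d²` in a finite set of natural numbers. -/
def sqEnergySet (s : Finset ℕ) : Finset ((ℕ × ℕ) × (ℕ × ℕ)) :=
  ((s ×ˢ s) ×ˢ (s ×ˢ s)).filter fun p => p.1.1 ^ 2 + p.1.2 ^ 2 = p.2.1 ^ 2 + p.2.2 ^ 2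

lemma integral_norm_pow_four_le (s : Finset ℕ) (w : ℕ → ℝ) (B : ℝ)
    (hw : ∀ n ∈ s, 0 ≤ w n ∧ w n ≤ B) :
    ∫ x in (0:ℝ)..1, ‖∑ n ∈ s, (w n : ℂ) * eChar (n ^ 2) x‖ ^ 4 ≤
      B ^ 4 * (sqEnergySet s).card := by
  have hpt : ∀ x : ℝ, ‖∑ n ∈ s, (w n : ℂ) * eChar (n ^ 2) x‖ ^ 4 =
      ‖∑ p ∈ s ×ˢ s, ((w p.1 * w p.2 : ℝ) : ℂ) * eChar (p.1 ^ 2 + p.2 ^ 2) x‖ ^ 2 := by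
    intro x
    rw [show (4 : ℕ) = 2 * 2 from rfl, pow_mul, ← norm_pow, sq (∑ n ∈ s, _),
      Finset.sum_mul_sum, Finset.sum_product]
    congr 2
    refine Finset.sum_congr rfl fun i _ => Finset.sum_congr rfl fun j _ => ?_
    rw [eChar_add]
    push_cast
    ring
  simp_rw [hpt]
  rw [integral_norm_sq_sum_eChar, ← Finset.sum_product', ← Finset.sum_filter, mul_comm,
    ← nsmul_eq_mul]
  refine Finset.sum_le_card_nsmul _ _ _ fun p hp => ?_
  simp only [Finset.mem_filter, Finset.mem_product] at hp
  obtain ⟨⟨⟨h1, h2⟩, h3, h4⟩, -⟩ := hp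
  have := hw _ h1
  have := hw _ h2
  have := hw _ h3
  have := hw _ h4
  have hB : 0 ≤ B := by linarith
  calc w p.1.1 * w p.1.2 * (w p.2.1 * w p.2.2) ≤ B * B * (B * B) := by
        gcongr <;> try tauto
        · exact mul_nonneg (by tauto) (by tauto)
    _ = B ^ 4 := by ring

/-- Every solution of `u v = w z` factors as `u = g x`, `w = g y`, `v = k y`, `z = k x`. -/
lemma exists_factor_of_mul_eq_mul {u v w z : ℕ} (hu : 0 < u) (hw : 0 < w)
    (h : u * v = w * z) :
    ∃ x y g k : ℕ, u = g * x ∧ w = g * y ∧ v = k * y ∧ z = k * x := by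
  obtain ⟨g, x, y, hg, hxy, rfl, rfl⟩ := Nat.exists_coprime' (Nat.gcd_pos_of_pos_left w hu)
  have hy : 0 < y := Nat.pos_of_mul_pos_right hw
  have hvz : x * v = y * z := Nat.eq_of_mul_eq_mul_left hg (by linarith)
  obtain ⟨k, rfl⟩ : y ∣ v := hxy.symm.dvd_of_dvd_mul_left ⟨z, hvz⟩
  refine ⟨x, y, g, k, mul_comm _ _, mul_comm _ _, mul_comm _ _, ?_⟩
  exact Nat.eq_of_mul_eq_mul_left hy (by linarith)

/-- The pairs of multipliers for which `g x, g y, k x, k y ≤ K`. -/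
def factorSet (K : ℕ) : Finset (Σ _ : ℕ × ℕ, ℕ × ℕ) :=
  (Finset.Icc 1 K ×ˢ Finset.Icc 1 K).sigma fun p =>
    Finset.Icc 1 (K / max p.1 p.2) ×ˢ Finset.Icc 1 (K / max p.1 p.2)

lemma card_factorSet_le (K : ℕ) :
    ((factorSet K).card : ℝ) ≤ 2 * K ^ 2 * (1 + Real.log K) := by
  have hterm : ∀ x y : ℕ, ((K / max x y : ℕ) : ℝ) * ((K / max x y : ℕ) : ℝ) ≤
      (if x ≤ y then (K : ℝ) ^ 2 * ((y : ℝ) ^ 2)⁻¹ else 0) +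
      (if y ≤ x then (K : ℝ) ^ 2 * ((x : ℝ) ^ 2)⁻¹ else 0) := by
    have key : ∀ m : ℕ, ((K / m : ℕ) : ℝ) * ((K / m : ℕ) : ℝ) ≤ K ^ 2 * ((m : ℝ) ^ 2)⁻¹ := by
      intro m
      calc ((K / m : ℕ) : ℝ) * ((K / m : ℕ) : ℝ) ≤ (K / m : ℝ) * (K / m : ℝ) := by
            gcongr <;> exact Nat.cast_div_le
        _ = K ^ 2 * ((m : ℝ) ^ 2)⁻¹ := by ring
    intro x y
    rcases le_total x y with h | h
    · rw [max_eq_right h, if_pos h]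
      exact (key y).trans (le_add_of_nonneg_right (by split_ifs <;> positivity))
    · rw [max_eq_left h, if_pos h]
      exact (key x).trans (le_add_of_nonneg_left (by split_ifs <;> positivity))
  have hinner : ∀ y ∈ Finset.Icc 1 K, ∑ x ∈ Finset.Icc 1 K,
      (if x ≤ y then (K : ℝ) ^ 2 * ((y : ℝ) ^ 2)⁻¹ else 0) = K ^ 2 * (y : ℝ)⁻¹ := by
    intro y hy
    rw [Finset.mem_Icc] at hy
    rw [← Finset.sum_filter, Finset.sum_const, nsmul_eq_mul]
    have : (Finset.Icc 1 K).filter (· ≤ y) = Finset.Icc 1 y := by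
      ext x
      simp only [Finset.mem_filter, Finset.mem_Icc]
      omega
    rw [this, Nat.card_Icc, Nat.add_sub_cancel]
    have : (y : ℝ) ≠ 0 := by
      have := hy.1
      positivity
    field_simp
  have hharm : ∑ y ∈ Finset.Icc 1 K, (y : ℝ)⁻¹ ≤ 1 + Real.log K := by
    have := harmonic_le_one_add_log K
    rw [harmonic_eq_sum_Icc] at this
    push_cast at this
    exact this
  have hcard : ((factorSet K).card : ℝ) = ∑ x ∈ Finset.Icc 1 K, ∑ y ∈ Finset.Icc 1 K,
      ((K / max x y : ℕ) : ℝ) * ((K / max x y : ℕ) : ℝ) := by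
    simp [factorSet, Finset.card_sigma, Finset.sum_product]
  rw [hcard]
  calc _ ≤ ∑ x ∈ Finset.Icc 1 K, ∑ y ∈ Finset.Icc 1 K,
        ((if x ≤ y then (K : ℝ) ^ 2 * ((y : ℝ) ^ 2)⁻¹ else 0) +
        (if y ≤ x then (K : ℝ) ^ 2 * ((x : ℝ) ^ 2)⁻¹ else 0)) :=
        Finset.sum_le_sum fun x _ => Finset.sum_le_sum fun y _ => hterm x y
    _ = 2 * (K : ℝ) ^ 2 * ∑ y ∈ Finset.Icc 1 K, (y : ℝ)⁻¹ := by
        simp_rw [Finset.sum_add_distrib]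
        rw [Finset.sum_comm, Finset.sum_congr rfl hinner, ← Finset.mul_sum]
        ring
    _ ≤ _ := by gcongr

lemma card_sqEnergySet_filter_lt_le (M : ℕ) :
    ((sqEnergySet (Finset.Ico M (2 * M))).filter fun p => p.2.1 < p.1.1).card ≤
      (factorSet (4 * M)).card := by
  let F : (Σ _ : ℕ × ℕ, ℕ × ℕ) → (ℕ × ℕ) × (ℕ × ℕ) := fun t =>
    (((t.2.1 * t.1.1 + t.2.2 * t.1.2) / 2, (t.2.2 * t.1.1 - t.2.1 * t.1.2) / 2),
      ((t.2.2 * t.1.2 - t.2.1 * t.1.1) / 2, (t.2.1 * t.1.2 + t.2.2 * t.1.1) / 2))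
  refine Finset.card_le_card_of_surjOn F ?_
  rintro ⟨⟨a, b⟩, c, d⟩ hp
  simp only [sqEnergySet, Finset.coe_filter, Finset.mem_filter, Finset.mem_product,
    Finset.mem_Ico, Set.mem_ofPred_eq] at hp
  obtain ⟨⟨⟨⟨ha, hb⟩, hc, hd⟩, heq⟩, hlt⟩ := hp
  have hbd : b < d := by nlinarith
  obtain ⟨u, rfl⟩ := Nat.exists_eq_add_of_lt hlt
  obtain ⟨w, rfl⟩ := Nat.exists_eq_add_of_lt hbd
  obtain ⟨x, y, g, k, h1, h2, h3, h4⟩ := exists_factor_of_mul_eq_mul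
    (u := u + 1) (v := c + u + 1 + c) (w := w + 1) (z := b + w + 1 + b)
    (by omega) (by omega) (by nlinarith)
  have hx : 0 < x := Nat.pos_of_ne_zero fun h => by simp [h] at h1
  have hy : 0 < y := Nat.pos_of_ne_zero fun h => by simp [h] at h2
  have hg : 0 < g := Nat.pos_of_ne_zero fun h => by simp [h] at h1
  have hk : 0 < k := Nat.pos_of_ne_zero fun h => by simp [h] at h3
  have hkx : x ≤ k * x := Nat.le_mul_of_pos_left x hk
  have hky : y ≤ k * y := Nat.le_mul_of_pos_left y hk
  have hm : 0 < max x y := lt_max_of_lt_left hx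
  refine ⟨⟨(x, y), (g, k)⟩, ?_, ?_⟩
  · simp only [factorSet, Finset.coe_sigma, Set.mem_sigma_iff, Finset.mem_coe,
      Finset.mem_product, Finset.mem_Icc, Nat.le_div_iff_mul_le hm]
    refine ⟨⟨⟨hx, by omega⟩, hy, by omega⟩, ⟨hg, ?_⟩, hk, ?_⟩
    · rcases max_choice x y with h | h <;> rw [h] <;> omega
    · rcases max_choice x y with h | h <;> rw [h] <;> omega
  · simp only [F, ← h1, ← h2, ← h3, ← h4, Prod.mk.injEq]
    omega

lemma card_sqEnergySet_le (M : ℕ) :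
    (sqEnergySet (Finset.Ico M (2 * M))).card ≤ M ^ 2 + 2 * (factorSet (4 * M)).card := by
  set E := sqEnergySet (Finset.Ico M (2 * M)) with hE
  have hgt := card_sqEnergySet_filter_lt_le M
  rw [← hE] at hgt
  have hlt : (E.filter fun p => p.1.1 < p.2.1).card ≤
      (E.filter fun p => p.2.1 < p.1.1).card := by
    refine Finset.card_le_card_of_injOn Prod.swap ?_ Prod.swap_injective.injOn
    rintro ⟨⟨a, b⟩, c, d⟩ hp
    simp only [hE, sqEnergySet, Finset.coe_filter, Finset.mem_filter, Finset.mem_product,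
      Set.mem_ofPred_eq, Prod.swap_prod_mk] at hp ⊢
    tauto
  have heq : (E.filter fun p => p.1.1 = p.2.1).card ≤ M ^ 2 := by
    have hsq : M ^ 2 = (Finset.Ico M (2 * M) ×ˢ Finset.Ico M (2 * M)).card := by
      rw [Finset.card_product, Nat.card_Ico, two_mul, Nat.add_sub_cancel, sq]
    rw [hsq]
    refine Finset.card_le_card_of_injOn Prod.fst ?_ ?_
    · rintro ⟨⟨a, b⟩, c, d⟩ hp
      simp only [hE, sqEnergySet, Finset.coe_filter, Finset.mem_filter, Finset.mem_product,
        Set.mem_ofPred_eq, Finset.mem_coe] at hp ⊢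
      tauto
    · have hd : ∀ p ∈ E.filter (fun p => p.1.1 = p.2.1), p.2 = p.1 := by
        rintro ⟨⟨a, b⟩, c, d⟩ hp
        simp only [hE, sqEnergySet, Finset.mem_filter] at hp
        obtain ⟨⟨-, h⟩, rfl⟩ := hp
        have : b = d := Nat.pow_left_injective two_ne_zero (Nat.add_left_cancel h)
        rw [this]
      intro p hp q hq hpq
      exact Prod.ext hpq (by rw [hd p hp, hd q hq, hpq])
  have hcover : E ⊆ (E.filter fun p => p.1.1 = p.2.1) ∪
      ((E.filter fun p => p.1.1 < p.2.1) ∪ (E.filter fun p => p.2.1 < p.1.1)) := by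
    intro p hp
    simp only [Finset.mem_union, Finset.mem_filter, hp, true_and]
    omega
  have h1 := Finset.card_le_card hcover
  have h2 := Finset.card_union_le (E.filter fun p => p.1.1 = p.2.1)
    ((E.filter fun p => p.1.1 < p.2.1) ∪ (E.filter fun p => p.2.1 < p.1.1))
  have h3 := Finset.card_union_le (E.filter fun p => p.1.1 < p.2.1)
    (E.filter fun p => p.2.1 < p.1.1)
  omega

lemma half_le_log {M : ℕ} (hM : 2 ≤ M) : Real.log 2 ≤ Real.log M ∧ 1 / 2 ≤ Real.log M := by
  have h : Real.log 2 ≤ Real.log M := Real.log_le_log (by norm_num) (by exact_mod_cast hM)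
  exact ⟨h, by linarith [Real.log_two_gt_d9]⟩

lemma integral_dyadic_block_le {M : ℕ} (hM : 2 ≤ M) :
    ∫ x in (0:ℝ)..1, ‖∑ n ∈ Finset.Ico M (2 * M), ((((n : ℝ) ^ 2)⁻¹ : ℝ) : ℂ) *
      eChar (n ^ 2) x‖ ^ 4 ≤ 322 * ((M : ℝ) ^ 6)⁻¹ * Real.log M := by
  have hM0 : (0 : ℝ) < M := by positivity
  obtain ⟨hlog2, hloghalf⟩ := half_le_log hM
  have hcard : ((sqEnergySet (Finset.Ico M (2 * M))).card : ℝ) ≤ 322 * M ^ 2 * Real.log M := by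
    have h1 : ((sqEnergySet (Finset.Ico M (2 * M))).card : ℝ) ≤
        M ^ 2 + 2 * (factorSet (4 * M)).card := by exact_mod_cast card_sqEnergySet_le M
    have h2 := card_factorSet_le (4 * M)
    have h3 : Real.log ((4 * M : ℕ) : ℝ) = 2 * Real.log 2 + Real.log M := by
      push_cast
      rw [Real.log_mul (by norm_num) hM0.ne', show (4 : ℝ) = 2 ^ 2 by norm_num, Real.log_pow]
      push_cast
      ring
    rw [h3] at h2
    push_cast at h2
    have h4 : (M : ℝ) ^ 2 * (1 + (2 * Real.log 2 + Real.log M)) ≤ M ^ 2 * (5 * Real.log M) := by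
      gcongr
      linarith
    have h5 : (M : ℝ) ^ 2 * 1 ≤ M ^ 2 * (2 * Real.log M) := by
      gcongr
      linarith
    nlinarith
  refine (integral_norm_pow_four_le _ _ ((M : ℝ) ^ 2)⁻¹ fun n hn => ⟨by positivity, ?_⟩).trans ?_
  · have : M ≤ n := (Finset.mem_Ico.mp hn).1
    gcongr
  · calc ((M : ℝ) ^ 2)⁻¹ ^ 4 * ((sqEnergySet (Finset.Ico M (2 * M))).card : ℝ)
        ≤ ((M : ℝ) ^ 2)⁻¹ ^ 4 * (322 * M ^ 2 * Real.log M) := by gcongr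
      _ = _ := by field_simp

lemma norm_add_pow_four_le {E : Type*} [SeminormedAddCommGroup E] (a b : E) :
    ‖a + b‖ ^ 4 ≤ 8 * ‖a‖ ^ 4 + 8 * ‖b‖ ^ 4 := by
  have h1 : ‖a + b‖ ^ 4 ≤ (‖a‖ + ‖b‖) ^ 4 := by
    gcongr
    exact norm_add_le a b
  have h2 := add_pow_le (norm_nonneg a) (norm_nonneg b) 4
  norm_num at h2
  linarith

lemma continuous_sum_inv_sq_mul_eChar (s : Finset ℕ) : Continuous fun x : ℝ =>
    ∑ n ∈ s, ((((n : ℝ) ^ 2)⁻¹ : ℝ) : ℂ) * eChar (n ^ 2) x :=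
  continuous_finsetSum _ fun _ _ => continuous_const.mul (continuous_eChar _)

lemma integral_dyadic_range_le (j : ℕ) {M : ℕ} (hM : 2 ≤ M) :
    ∫ x in (0:ℝ)..1, ‖∑ n ∈ Finset.Ico M (2 ^ j * M), ((((n : ℝ) ^ 2)⁻¹ : ℝ) : ℂ) *
      eChar (n ^ 2) x‖ ^ 4 ≤ 4000 * ((M : ℝ) ^ 6)⁻¹ * Real.log M := by
  induction j generalizing M with
  | zero =>
    have : 0 ≤ Real.log M := Real.log_natCast_nonneg M
    simp
    positivity
  | succ j ih =>
    have hM0 : (0 : ℝ) < M := by positivity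
    obtain ⟨hlog2, hloghalf⟩ := half_le_log hM
    have hi : ∀ s : Finset ℕ, IntervalIntegrable (fun x : ℝ => 8 *
        ‖∑ n ∈ s, ((((n : ℝ) ^ 2)⁻¹ : ℝ) : ℂ) * eChar (n ^ 2) x‖ ^ 4) volume 0 1 := fun s =>
      (continuous_const.mul
        ((continuous_sum_inv_sq_mul_eChar s).norm.pow 4)).intervalIntegrable _ _
    have hle : 2 * M ≤ 2 ^ (j + 1) * M := by
      gcongr
      exact le_self_pow₀ (by norm_num) (by omega)
    have hmono : ∫ x in (0:ℝ)..1, ‖∑ n ∈ Finset.Ico M (2 ^ (j + 1) * M),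
        ((((n : ℝ) ^ 2)⁻¹ : ℝ) : ℂ) * eChar (n ^ 2) x‖ ^ 4 ≤
        ∫ x in (0:ℝ)..1, (8 * ‖∑ n ∈ Finset.Ico M (2 * M),
          ((((n : ℝ) ^ 2)⁻¹ : ℝ) : ℂ) * eChar (n ^ 2) x‖ ^ 4 +
        8 * ‖∑ n ∈ Finset.Ico (2 * M) (2 ^ (j + 1) * M),
          ((((n : ℝ) ^ 2)⁻¹ : ℝ) : ℂ) * eChar (n ^ 2) x‖ ^ 4) := by
      refine intervalIntegral.integral_mono_on zero_le_one
        (((continuous_sum_inv_sq_mul_eChar _).norm.pow 4).intervalIntegrable _ _)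
        ((hi _).add (hi _)) fun x _ => ?_
      rw [← Finset.sum_Ico_consecutive _ (by omega : M ≤ 2 * M) hle]
      exact norm_add_pow_four_le _ _
    rw [intervalIntegral.integral_add (hi _) (hi _), intervalIntegral.integral_const_mul,
      intervalIntegral.integral_const_mul] at hmono
    have hblock := integral_dyadic_block_le hM
    have htail := ih (M := 2 * M) (by omega)
    rw [show 2 ^ j * (2 * M) = 2 ^ (j + 1) * M by ring] at htail
    have hlog : Real.log ((2 * M : ℕ) : ℝ) ≤ 2 * Real.log M := by
      push_cast
      rw [Real.log_mul (by norm_num) hM0.ne']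
      linarith
    have htail' : 4000 * (((2 * M : ℕ) : ℝ) ^ 6)⁻¹ * Real.log ((2 * M : ℕ) : ℝ) ≤
        125 * (((M : ℝ) ^ 6)⁻¹ * Real.log M) := by
      calc 4000 * (((2 * M : ℕ) : ℝ) ^ 6)⁻¹ * Real.log ((2 * M : ℕ) : ℝ)
          ≤ 4000 * (((2 * M : ℕ) : ℝ) ^ 6)⁻¹ * (2 * Real.log M) := by gcongr
        _ = _ := by
          push_cast
          rw [mul_pow, mul_inv]
          ring
    have hpos : 0 ≤ ((M : ℝ) ^ 6)⁻¹ * Real.log M := by positivity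
    linarith

/-- The high-pass filter as a sum over the square roots of the frequencies. -/
lemma hasSum_riemannHigh {N M : ℕ} (hNM : ∀ n : ℕ, N ≤ n ^ 2 ↔ M ≤ n) (x : ℝ) :
    HasSum (fun n : ℕ => if M ≤ n then ((((n : ℝ) ^ 2)⁻¹ : ℝ) : ℂ) * eChar (n ^ 2) x else 0)
      (RiemannHigh N x) := by
  have hinj : Function.Injective fun n : ℕ => n ^ 2 := Nat.pow_left_injective two_ne_zero
  set f : ℕ → ℂ := fun k => if N ≤ k then ((sqIndicator k / k : ℝ) : ℂ) * eChar k x else 0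
    with hf
  have hcomp : (fun n : ℕ => if M ≤ n then ((((n : ℝ) ^ 2)⁻¹ : ℝ) : ℂ) * eChar (n ^ 2) x
      else 0) = f ∘ fun n : ℕ => n ^ 2 := by
    ext n
    simp [hf, hNM, sqIndicator, IsSquare.sq]
  have hsupp : ∀ k ∉ Set.range (fun n : ℕ => n ^ 2), f k = 0 := by
    intro k hk
    have : ¬ IsSquare k := fun ⟨r, hr⟩ => hk ⟨r, by simp [hr, sq]⟩
    simp [hf, sqIndicator, this]
  have hsum : Summable (f ∘ fun n : ℕ => n ^ 2) := by
    rw [← hcomp]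
    refine Summable.of_norm_bounded (Real.summable_nat_pow_inv.mpr one_lt_two) fun n => ?_
    split_ifs
    · rw [norm_mul, norm_eChar, mul_one, Complex.norm_real, Real.norm_of_nonneg (by positivity)]
    · simp
  rw [hcomp, hinj.hasSum_iff hsupp]
  exact ((hinj.summable_iff hsupp).mp hsum).hasSum

lemma integral_riemannHigh_le {N M : ℕ} (hNM : ∀ n : ℕ, N ≤ n ^ 2 ↔ M ≤ n) (hM : 2 ≤ M) :
    ∫ x in (0:ℝ)..1, ‖RiemannHigh N x‖ ^ 4 ≤ 4000 * ((M : ℝ) ^ 6)⁻¹ * Real.log M := by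
  have hsumm : Summable fun n : ℕ => ((n : ℝ) ^ 2)⁻¹ := Real.summable_nat_pow_inv.mpr one_lt_two
  have hlim : Filter.Tendsto (fun j : ℕ => 2 ^ j * M) Filter.atTop Filter.atTop :=
    (tendsto_pow_atTop_atTop_of_one_lt one_lt_two).atTop_mul_const' (by omega)
  have hpt : ∀ x : ℝ, Filter.Tendsto (fun j : ℕ => ∑ n ∈ Finset.Ico M (2 ^ j * M),
      ((((n : ℝ) ^ 2)⁻¹ : ℝ) : ℂ) * eChar (n ^ 2) x) Filter.atTop (nhds (RiemannHigh N x)) := by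
    intro x
    refine ((hasSum_riemannHigh hNM x).tendsto_sum_nat.comp hlim).congr fun j => ?_
    rw [Function.comp_apply, ← Finset.sum_filter]
    congr 1
    ext n
    simp only [Finset.mem_filter, Finset.mem_range, Finset.mem_Ico]
    tauto
  have hintegral : Filter.Tendsto (fun j : ℕ => ∫ x in (0:ℝ)..1, ‖∑ n ∈ Finset.Ico M (2 ^ j * M),
      ((((n : ℝ) ^ 2)⁻¹ : ℝ) : ℂ) * eChar (n ^ 2) x‖ ^ 4) Filter.atTop
      (nhds (∫ x in (0:ℝ)..1, ‖RiemannHigh N x‖ ^ 4)) := by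
    refine intervalIntegral.tendsto_integral_filter_of_dominated_convergence
      (fun _ => (∑' n : ℕ, ((n : ℝ) ^ 2)⁻¹) ^ 4) ?_ ?_ ?_ ?_
    · exact Filter.Eventually.of_forall fun j =>
        ((continuous_sum_inv_sq_mul_eChar _).norm.pow 4).aestronglyMeasurable
    · refine Filter.Eventually.of_forall fun j => Filter.Eventually.of_forall fun x _ => ?_
      rw [norm_pow, norm_norm]
      gcongr
      refine (norm_sum_le _ _).trans (le_trans (Finset.sum_le_sum fun n _ => ?_)
        (hsumm.sum_le_tsum _ fun n _ => by positivity))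
      rw [norm_mul, norm_eChar, mul_one, Complex.norm_real, Real.norm_of_nonneg (by positivity)]
    · exact intervalIntegrable_const
    · exact Filter.Eventually.of_forall fun x _ => (hpt x).norm.pow 4
  exact le_of_tendsto' hintegral fun j => integral_dyadic_range_le j hM

/-- There exist `C > 0` and `N₀ ∈ ℕ` such that for every integer `N ≥ N₀`,
`‖R_{≥N}‖_{L⁴(𝕋)} ≤ C · N^{-3/4} · (log N)^{1/4}`. -/
theorem riemann_highpass_L4_upper :
    ∃ C : ℝ, 0 < C ∧ ∃ N₀ : ℕ, ∀ N : ℕ, N₀ ≤ N →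
      (∫ x in (0:ℝ)..1, ‖RiemannHigh N x‖ ^ 4) ^ ((1:ℝ)/4) ≤
        C * (N : ℝ) ^ (-(3 : ℝ)/4) * (Real.log N) ^ ((1:ℝ)/4) := by
  refine ⟨4000 ^ ((1:ℝ)/4), by positivity, 2, fun N hN => ?_⟩
  obtain ⟨M, hNM⟩ : ∃ M : ℕ, ∀ n : ℕ, N ≤ n ^ 2 ↔ M ≤ n := by
    refine ⟨Nat.sqrt (N - 1) + 1, fun n => ?_⟩
    rw [Nat.succ_le_iff, Nat.sqrt_lt']
    omega
  have hNsq : N ≤ M ^ 2 := (hNM M).mpr le_rfl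
  have hM : 2 ≤ M := by
    by_contra! h
    have : M ^ 2 ≤ 1 ^ 2 := by gcongr; omega
    omega
  have hMN : M ≤ N := (hNM N).mp (by nlinarith)
  have hN0 : (0 : ℝ) < N := by positivity
  have hlog : 0 ≤ Real.log N := Real.log_natCast_nonneg N
  have hbound : ∫ x in (0:ℝ)..1, ‖RiemannHigh N x‖ ^ 4 ≤
      4000 * ((N : ℝ) ^ 3)⁻¹ * Real.log N := by
    have hcast : (N : ℝ) ≤ (M : ℝ) ^ 2 := by exact_mod_cast hNsq
    have hpow : (N : ℝ) ^ 3 ≤ (M : ℝ) ^ 6 := by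
      calc (N : ℝ) ^ 3 ≤ ((M : ℝ) ^ 2) ^ 3 := by gcongr
        _ = (M : ℝ) ^ 6 := by ring
    refine (integral_riemannHigh_le hNM hM).trans ?_
    gcongr
  have hnonneg : 0 ≤ ∫ x in (0:ℝ)..1, ‖RiemannHigh N x‖ ^ 4 :=
    intervalIntegral.integral_nonneg zero_le_one fun x _ => by positivity
  calc (∫ x in (0:ℝ)..1, ‖RiemannHigh N x‖ ^ 4) ^ ((1:ℝ)/4)
      ≤ (4000 * ((N : ℝ) ^ 3)⁻¹ * Real.log N) ^ ((1:ℝ)/4) := by gcongr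
    _ = _ := by
      rw [Real.mul_rpow (by positivity) hlog, Real.mul_rpow (by norm_num) (by positivity)]
      congr 2
      rw [← Real.rpow_natCast, ← Real.rpow_neg hN0.le, ← Real.rpow_mul hN0.le]
      norm_num
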